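/- arXiv:0910.5838 — 5 statements merged into one kernel-verified Lean document; each statement's English description precedes it below -/
import Mathlib

section
/- Let (φ, ξ, η) be an almost paracontact structure on a real vector space V of dimension 2n+1, let g be a compatible metric, and let h : V → V be a linear map satisfying h ∘ φ = −φ ∘ h, g(hX, Y) = g(X, hY) for all X, Y, h(ξ) = 0, and h² = φ². Then: (a) the eigenspaces [+1] := ker(h − id) and [−1] := ker(h + id) are contained in ker η; (b) V = ℝξ ⊕ [+1] ⊕ [−1]; (c) [+1] and [−1] are g-orthogonal to each other and to ξ; (d) φ maps [+1] bijectively onto [−1], so dim [+1] = dim [−1] = n; (e) ker h = ℝξ, so h has rank 2n. (This is the algebraic content of the statement that if the sectional curvatures of all plane sections containing ξ vanish, then h has rank 2n and the paracontact distribution decomposes into the ±1 eigenspaces of h.) -/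
/-- For an almost paracontact structure `(φ, ξ, η)` with compatible metric `g`
on a `(2n+1)`-dimensional real vector space `V`, and a linear operator `h`
with `h ∘ φ = -φ ∘ h`, `g (h X) Y = g X (h Y)`, `h ξ = 0` and `h² = φ²`:
(a) the eigenspaces `[+1] = ker (h - id)` and `[-1] = ker (h + id)` lie in
`ker η`; (b) `V = ℝξ ⊕ [+1] ⊕ [-1]`; (c) `[+1]` and `[-1]` are `g`-orthogonal
to each other and to `ξ`; (d) `φ` maps `[+1]` bijectively onto `[-1]`, so
`dim [+1] = dim [-1] = n`; (e) `ker h = ℝξ`, so `h` has rank `2n`. -/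
theorem almostParacontactMetric_h_eigenspace_decomposition
    (V : Type*) [AddCommGroup V] [Module ℝ V] [FiniteDimensional ℝ V]
    (n : ℕ) (φ h : V →ₗ[ℝ] V) (ξ : V) (η : V →ₗ[ℝ] ℝ)
    (g : V →ₗ[ℝ] V →ₗ[ℝ] ℝ)
    (hdim : Module.finrank ℝ V = 2 * n + 1)
    (hηξ : η ξ = 1)
    (hφφ : ∀ X : V, φ (φ X) = X - η X • ξ)
    (hsym : ∀ X Y : V, g X Y = g Y X)
    (hnd : ∀ X : V, (∀ Y : V, g X Y = 0) → X = 0)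
    (hcompat : ∀ X Y : V, g (φ X) (φ Y) = -(g X Y) + η X * η Y)
    (hanti : ∀ X : V, h (φ X) = -φ (h X))
    (hsymh : ∀ X Y : V, g (h X) Y = g X (h Y))
    (hhξ : h ξ = 0)
    (hh2 : ∀ X : V, h (h X) = φ (φ X)) :
    (LinearMap.ker (h - LinearMap.id) ≤ LinearMap.ker η ∧
     LinearMap.ker (h + LinearMap.id) ≤ LinearMap.ker η) ∧
    (∀ X : V, ∃! t : ℝ × V × V,
        t.2.1 ∈ LinearMap.ker (h - LinearMap.id) ∧
        t.2.2 ∈ LinearMap.ker (h + LinearMap.id) ∧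
        X = t.1 • ξ + t.2.1 + t.2.2) ∧
    ((∀ X ∈ LinearMap.ker (h - LinearMap.id),
        ∀ Y ∈ LinearMap.ker (h + LinearMap.id), g X Y = 0) ∧
     (∀ X ∈ LinearMap.ker (h - LinearMap.id), g X ξ = 0) ∧
     (∀ Y ∈ LinearMap.ker (h + LinearMap.id), g Y ξ = 0)) ∧
    (Submodule.map φ (LinearMap.ker (h - LinearMap.id)) =
        LinearMap.ker (h + LinearMap.id) ∧
     (∀ X ∈ LinearMap.ker (h - LinearMap.id), φ X = 0 → X = 0) ∧
     Module.finrank ℝ (LinearMap.ker (h - LinearMap.id)) = n ∧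
     Module.finrank ℝ (LinearMap.ker (h + LinearMap.id)) = n) ∧
    (LinearMap.ker h = Submodule.span ℝ {ξ} ∧
     Module.finrank ℝ (LinearMap.range h) = 2 * n) := by
  have hξ0 : ξ ≠ 0 := by
    intro e
    rw [e, map_zero] at hηξ
    exact zero_ne_one hηξ
  have mp : ∀ X, X ∈ LinearMap.ker (h - LinearMap.id) ↔ h X = X := by
    intro X
    simp [LinearMap.mem_ker, sub_eq_zero]
  have mm : ∀ X, X ∈ LinearMap.ker (h + LinearMap.id) ↔ h X = -X := by
    intro X
    simp [LinearMap.mem_ker, add_eq_zero_iff_eq_neg]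
  have hhh : ∀ X, h (h X) = X - η X • ξ := fun X => (hh2 X).trans (hφφ X)
  have key : ∀ X, h (h X) = X → η X = 0 := by
    intro X e
    rw [hhh] at e
    have : η X • ξ = 0 := by simpa using e
    exact (smul_eq_zero.mp this).resolve_right hξ0
  have ap : ∀ X, h X = X → η X = 0 := fun X e => key X (by rw [e, e])
  have am : ∀ X, h X = -X → η X = 0 := fun X e => key X (by rw [e, map_neg, e, neg_neg])
  have hφξ : φ ξ = 0 := by
    have e1 : φ (φ ξ) = 0 := by rw [hφφ, hηξ]; simp
    have e2 : φ ξ = η (φ ξ) • ξ := by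
      have := hφφ (φ ξ)
      rw [e1, map_zero] at this
      exact (sub_eq_zero.mp this.symm)
    have e3 : η (φ ξ) • φ ξ = 0 := by
      rw [← map_smul, ← e2, e1]
    rcases smul_eq_zero.mp e3 with e | e
    · rw [e2, e, zero_smul]
    · exact e
  have hgξ : ∀ X, g X ξ = η X := by
    intro X
    have := hcompat X ξ
    rw [hφξ, map_zero, hηξ] at this
    linarith
  have hηh : ∀ X, η (h X) = 0 := by
    intro X
    apply key
    rw [hhh X, map_sub, map_smul, hhξ, smul_zero, sub_zero]
  have php : ∀ X, h X = X → h (φ X) = -(φ X) := fun X e => by rw [hanti, e]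
  have phm : ∀ X, h X = -X → h (φ X) = φ X := fun X e => by rw [hanti, e, map_neg, neg_neg]
  have map1 : Submodule.map φ (LinearMap.ker (h - LinearMap.id)) =
        LinearMap.ker (h + LinearMap.id) := by
    ext Y
    rw [Submodule.mem_map, mm]
    constructor
    · rintro ⟨X, hX, rfl⟩
      exact php X ((mp X).1 hX)
    · intro e
      exact ⟨φ Y, (mp _).2 (phm Y e), by rw [hφφ, am Y e, zero_smul, sub_zero]⟩
  have map2 : Submodule.map φ (LinearMap.ker (h + LinearMap.id)) =
        LinearMap.ker (h - LinearMap.id) := by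
    ext Y
    rw [Submodule.mem_map, mp]
    constructor
    · rintro ⟨X, hX, rfl⟩
      exact phm X ((mm X).1 hX)
    · intro e
      exact ⟨φ Y, (mm _).2 (php Y e), by rw [hφφ, ap Y e, zero_smul, sub_zero]⟩
  have kerh : LinearMap.ker h = Submodule.span ℝ {ξ} := by
    ext X
    rw [LinearMap.mem_ker, Submodule.mem_span_singleton]
    constructor
    · intro e
      refine ⟨η X, ?_⟩
      have := hhh X
      rw [e, map_zero] at this
      exact (sub_eq_zero.mp this.symm).symm
    · rintro ⟨a, rfl⟩
      rw [map_smul, hhξ, smul_zero]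
  have rk : Module.finrank ℝ (LinearMap.range h) = 2 * n := by
    have := LinearMap.finrank_range_add_finrank_ker h
    rw [kerh, finrank_span_singleton hξ0, hdim] at this
    omega
  have rng : LinearMap.ker (h - LinearMap.id) ⊔ LinearMap.ker (h + LinearMap.id)
      = LinearMap.range h := by
    apply le_antisymm
    · apply sup_le
      · intro X hX
        exact ⟨X, (mp X).1 hX⟩
      · intro X hX
        exact ⟨-X, by rw [map_neg, (mm X).1 hX, neg_neg]⟩
    · rintro _ ⟨Y, rfl⟩
      have e : h (h (h Y)) = h Y := by rw [hhh (h Y), hηh, zero_smul, sub_zero]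
      rw [Submodule.mem_sup]
      refine ⟨(1/2 : ℝ) • (h Y + h (h Y)), (mp _).2 ?_, (1/2 : ℝ) • (h Y - h (h Y)),
        (mm _).2 ?_, ?_⟩
      · rw [map_smul, map_add, e, add_comm]
      · rw [map_smul, map_sub, e, ← smul_neg, neg_sub]
      · module
  have inf0 : LinearMap.ker (h - LinearMap.id) ⊓ LinearMap.ker (h + LinearMap.id) = ⊥ := by
    rw [eq_bot_iff]
    rintro X ⟨h1, h2⟩
    have e1 := (mp X).1 h1
    have e2 := (mm X).1 h2
    rw [e1] at e2
    have e3 : (2 : ℝ) • X = 0 := by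
      rw [two_smul]
      nth_rewrite 1 [e2]
      exact neg_add_cancel X
    exact (smul_eq_zero.mp e3).resolve_left two_ne_zero
  have dsum := Submodule.finrank_sup_add_finrank_inf_eq
    (LinearMap.ker (h - LinearMap.id)) (LinearMap.ker (h + LinearMap.id))
  rw [rng, inf0, rk, finrank_bot] at dsum
  have l1 := Submodule.finrank_map_le φ (LinearMap.ker (h - LinearMap.id))
  have l2 := Submodule.finrank_map_le φ (LinearMap.ker (h + LinearMap.id))
  rw [map1] at l1
  rw [map2] at l2
  refine ⟨⟨fun X hX => ap X ((mp X).1 hX), fun X hX => am X ((mm X).1 hX)⟩, ?_,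
    ⟨?_, ?_, ?_⟩, ⟨map1, ?_, by omega, by omega⟩, kerh, rk⟩
  · intro X
    refine ⟨(η X, (1/2 : ℝ) • (h X + h (h X)), (1/2 : ℝ) • (h (h X) - h X)), ⟨?_, ?_, ?_⟩, ?_⟩
    · rw [mp]
      simp only [map_smul, map_add]
      rw [hhh (h X), hηh, zero_smul, sub_zero, add_comm]
    · rw [mm]
      simp only [map_smul, map_sub]
      rw [hhh (h X), hηh, zero_smul, sub_zero, ← smul_neg, neg_sub]
    · simp only [hhh]
      module
    · rintro ⟨t, a, b⟩ ⟨ha, hb, hX⟩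
      simp only at ha hb hX
      rw [mp] at ha
      rw [mm] at hb
      have e1 : η X = t := by
        rw [hX]
        simp [hηξ, ap a ha, am b hb]
      have e2 : h X = a - b := by
        rw [hX]
        simp only [map_add, map_smul, hhξ, ha, hb]
        module
      have e3 : h (h X) = a + b := by
        rw [e2, map_sub, ha, hb, sub_neg_eq_add]
      rw [e3, e2, e1]
      refine Prod.ext rfl (Prod.ext ?_ ?_)
      · simp only
        module
      · simp only
        module
  · intro X hX Y hY
    have := hsymh X Y
    rw [(mp X).1 hX, (mm Y).1 hY, map_neg] at this
    linarith
  · intro X hX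
    rw [hgξ, ap X ((mp X).1 hX)]
  · intro X hX
    rw [hgξ, am X ((mm X).1 hX)]
  · intro X hX e
    have := hφφ X
    rw [e, map_zero, ap X ((mp X).1 hX), zero_smul, sub_zero] at this
    exact this.symm
end

section
/- For every p ∈ ℝ³ and u, v ∈ ℝ³, the constant pseudo-Riemannian metric g(u, v) = ¼(u₁v₁ − u₂v₂ + u₃v₃) is compatible with the explicitly defined almost paracontact structure: g(φ_p(u), φ_p(v)) = −g(u, v) + η_p(u)·η_p(v). -/
/-- The 1-form `η_p(v) = ½(cosh(p₃)v₁ + sinh(p₃)v₂)` on `ℝ³`. -/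
noncomputable def pcEta (p v : Fin 3 → ℝ) : ℝ :=
  (Real.cosh (p 2) * v 0 + Real.sinh (p 2) * v 1) / 2

/-- The (1,1)-tensor field
`φ_p(v) = (−sinh(p₃)v₃, cosh(p₃)v₃, sinh(p₃)v₁ + cosh(p₃)v₂)` on `ℝ³`. -/
noncomputable def pcPhi (p v : Fin 3 → ℝ) : Fin 3 → ℝ :=
  ![-(Real.sinh (p 2) * v 2), Real.cosh (p 2) * v 2,
    Real.sinh (p 2) * v 0 + Real.cosh (p 2) * v 1]

/-- The constant pseudo-Riemannian metric `g(u,v) = ¼(u₁v₁ − u₂v₂ + u₃v₃)`. -/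
noncomputable def pcG (u v : Fin 3 → ℝ) : ℝ :=
  (u 0 * v 0 - u 1 * v 1 + u 2 * v 2) / 4

/-- The constant metric `g` is compatible with the explicit almost paracontact
structure on `ℝ³`: `g(φ_p u, φ_p v) = −g(u,v) + η_p(u)·η_p(v)`. -/
theorem pc_example_metric_compatible (p u v : Fin 3 → ℝ) :
    pcG (pcPhi p u) (pcPhi p v) = -(pcG u v) + pcEta p u * pcEta p v := by
  have h := Real.cosh_sq (p 2)
  simp only [pcG, pcPhi, pcEta, Matrix.cons_val]
  linear_combination (-(u 0 * v 0) + u 1 * v 1 - u 2 * v 2) / 4 * h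
end

section
/- For every p ∈ ℝ³ and u, v ∈ ℝ³, the explicitly defined structure on ℝ³ satisfies the paracontact metric condition dη_p(u, v) = g(u, φ_p(v)), where dη is computed from η by the derivative formula dη_p(u, v) = ½(D_u[q ↦ η_q(v)](p) − D_v[q ↦ η_q(u)](p)) with D the Fréchet derivative. (Hence (ℝ³, φ, ξ, η, g) is a flat paracontact metric manifold, since g has constant coefficients.) -/
theorem pc_fderiv_aux (p u v : Fin 3 → ℝ) :
    fderiv ℝ (fun q => pcEta q v) p u
      = u 2 * (Real.sinh (p 2) * v 0 + Real.cosh (p 2) * v 1) / 2 := by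
  have h2 : HasFDerivAt (fun q : Fin 3 → ℝ => q 2)
      (ContinuousLinearMap.proj (R := ℝ) (φ := fun _ : Fin 3 => ℝ) 2) p :=
    hasFDerivAt_apply 2 p
  have hd : HasDerivAt (fun t : ℝ => (Real.cosh t * v 0 + Real.sinh t * v 1) / 2)
      ((Real.sinh (p 2) * v 0 + Real.cosh (p 2) * v 1) / 2) (p 2) :=
    (((Real.hasDerivAt_cosh (p 2)).mul_const (v 0)).add
      ((Real.hasDerivAt_sinh (p 2)).mul_const (v 1))).div_const 2
  have h0 := hd.comp_hasFDerivAt p h2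
  have h : fderiv ℝ (fun q => pcEta q v) p = _ := h0.fderiv
  rw [h]
  simp
  ring

/-- The explicit structure on `ℝ³` satisfies the paracontact metric condition
`dη_p(u,v) = g(u, φ_p v)`, where
`dη_p(u,v) = ½(D_u[q ↦ η_q(v)](p) − D_v[q ↦ η_q(u)](p))` with `D` the Fréchet
derivative. -/
theorem pc_example_deta_eq_g_phi (p u v : Fin 3 → ℝ) :
    (fderiv ℝ (fun q => pcEta q v) p u - fderiv ℝ (fun q => pcEta q u) p v) / 2
      = pcG u (pcPhi p v) := by
  rw [pc_fderiv_aux, pc_fderiv_aux]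
  simp [pcG, pcPhi]
  ring
end

section
/- Let f : ℝ³ → ℝ³ be given by f(x, y, z) = (z·cosh(x) − y·sinh(x), z·sinh(x) − y·cosh(x), −x), and let η be the 1-form on ℝ³ defined by η_q(w) = ½(cosh(q₃)w₁ + sinh(q₃)w₂). Then the pullback f*η equals the standard paracontact form η₀ = ½(dz − y dx): for every p = (x, y, z) ∈ ℝ³ and every v = (v₁, v₂, v₃) ∈ ℝ³, η_{f(p)}((Df)_p(v)) = ½(v₃ − y·v₁), where (Df)_p denotes the Fréchet derivative of f at p. -/
/-- The map `f(x,y,z) = (z·cosh x − y·sinh x, z·sinh x − y·cosh x, −x)`. -/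
noncomputable def pcf (p : Fin 3 → ℝ) : Fin 3 → ℝ :=
  ![p 2 * Real.cosh (p 0) - p 1 * Real.sinh (p 0),
    p 2 * Real.sinh (p 0) - p 1 * Real.cosh (p 0),
    -p 0]

/-- The pullback `f*η` equals the standard paracontact form
`η₀ = ½(dz − y dx)`: for every `p = (x,y,z)` and `v`,
`η_{f(p)}((Df)_p v) = ½(v₃ − y·v₁)`. -/
theorem pc_example_pullback_eta (p v : Fin 3 → ℝ) :
    pcEta (pcf p) (fderiv ℝ pcf p v) = (v 2 - p 1 * v 0) / 2 := by
  have h0 : HasFDerivAt (fun q : Fin 3 → ℝ => q 0)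
      (ContinuousLinearMap.proj (R := ℝ) (φ := fun _ : Fin 3 => ℝ) 0) p := hasFDerivAt_apply 0 p
  have h1 : HasFDerivAt (fun q : Fin 3 → ℝ => q 1)
      (ContinuousLinearMap.proj (R := ℝ) (φ := fun _ : Fin 3 => ℝ) 1) p := hasFDerivAt_apply 1 p
  have h2 : HasFDerivAt (fun q : Fin 3 → ℝ => q 2)
      (ContinuousLinearMap.proj (R := ℝ) (φ := fun _ : Fin 3 => ℝ) 2) p := hasFDerivAt_apply 2 p
  have A := (h2.mul h0.cosh).sub (h1.mul h0.sinh)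
  have B := (h2.mul h0.sinh).sub (h1.mul h0.cosh)
  have hd : DifferentiableAt ℝ pcf p := by
    rw [differentiableAt_pi]
    intro i
    fin_cases i
    · exact A.differentiableAt
    · exact B.differentiableAt
    · exact h0.neg.differentiableAt
  have e := hasFDerivAt_pi'.1 hd.hasFDerivAt
  have a := congrArg (fun L => L v) ((e 0).unique A)
  have b := congrArg (fun L => L v) ((e 1).unique B)
  simp at a b
  have c : pcf p 2 = - p 0 := rfl
  unfold pcEta
  rw [a, b, c, Real.cosh_neg, Real.sinh_neg]
  have := Real.cosh_sq (p 0)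
  linear_combination ((v 2 - p 1 * v 0) / 2) * this
end

section
/- Let f(x, y, z) = (z·cosh(x) − y·sinh(x), z·sinh(x) − y·cosh(x), −x) with inverse F(a, b, c) = (−c, −a·sinh(c) − b·cosh(c), a·cosh(c) + b·sinh(c)), and on ℝ³ define η_q(w) = ½(cosh(q₃)w₁ + sinh(q₃)w₂), φ_q(w) = (−sinh(q₃)w₃, cosh(q₃)w₃, sinh(q₃)w₁ + cosh(q₃)w₂) and g(u, v) = ¼(u₁v₁ − u₂v₂ + u₃v₃). Define the pullbacks η₀ := f*η (so η₀_p(v) = ½(v₃ − p₂v₁)), g₀_p(u, v) := g((Df)_p(u), (Df)_p(v)), and φ₀_p := (DF)_{f(p)} ∘ φ_{f(p)} ∘ (Df)_p. Then (η₀, g₀, φ₀) is a paracontact metric structure for the standard paracontact form: for all p, u, v ∈ ℝ³, dη₀_p(u, v) = g₀_p(u, φ₀_p(v)), where dη₀ is computed from η₀ by the derivative formula dη₀_p(u, v) = ½(D_u[q ↦ η₀_q(v)](p) − D_v[q ↦ η₀_q(u)](p)). (Thus g₀ = f*g is an associated metric for η₀ = ½(dz − y dx).) -/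
/-- The inverse map `F(a,b,c) = (−c, −a·sinh c − b·cosh c, a·cosh c + b·sinh c)`. -/
noncomputable def pcF (q : Fin 3 → ℝ) : Fin 3 → ℝ :=
  ![-q 2,
    -(q 0 * Real.sinh (q 2)) - q 1 * Real.cosh (q 2),
    q 0 * Real.cosh (q 2) + q 1 * Real.sinh (q 2)]

/-- The pullback 1-form `η₀ = f*η`, i.e. `η₀_p(v) = η_{f(p)}((Df)_p v)`. -/
noncomputable def pcEta₀ (p v : Fin 3 → ℝ) : ℝ :=
  pcEta (pcf p) (fderiv ℝ pcf p v)

/-- The pullback metric `g₀ = f*g`, i.e. `g₀_p(u,v) = g((Df)_p u, (Df)_p v)`. -/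
noncomputable def pcG₀ (p u v : Fin 3 → ℝ) : ℝ :=
  pcG (fderiv ℝ pcf p u) (fderiv ℝ pcf p v)

/-- The pullback tensor `φ₀_p = (DF)_{f(p)} ∘ φ_{f(p)} ∘ (Df)_p`. -/
noncomputable def pcPhi₀ (p v : Fin 3 → ℝ) : Fin 3 → ℝ :=
  fderiv ℝ pcF (pcf p) (pcPhi (pcf p) (fderiv ℝ pcf p v))

lemma aux_coord (i : Fin 3) (p : Fin 3 → ℝ) :
    HasFDerivAt (fun q : Fin 3 → ℝ => q i) (ContinuousLinearMap.proj (R := ℝ) (φ := fun _ : Fin 3 => ℝ) i) p :=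
  (ContinuousLinearMap.proj (R := ℝ) (φ := fun _ : Fin 3 => ℝ) i).hasFDerivAt

lemma aux_vec (a b c : (Fin 3 → ℝ) → ℝ) (a' b' c' : (Fin 3 → ℝ) →L[ℝ] ℝ) (p v : Fin 3 → ℝ)
    (ha : HasFDerivAt a a' p) (hb : HasFDerivAt b b' p) (hc : HasFDerivAt c c' p) :
    fderiv ℝ (fun q => ![a q, b q, c q]) p v = ![a' v, b' v, c' v] := by
  have h : HasFDerivAt (fun q => ![a q, b q, c q]) (ContinuousLinearMap.pi ![a', b', c']) p := by
    rw [hasFDerivAt_pi']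
    intro i
    fin_cases i
    · exact ha
    · exact hb
    · exact hc
  rw [h.fderiv]
  ext i
  fin_cases i <;> rfl

lemma aux_f (p v : Fin 3 → ℝ) : fderiv ℝ pcf p v =
    ![v 2 * Real.cosh (p 0) - v 1 * Real.sinh (p 0)
        + (p 2 * Real.sinh (p 0) - p 1 * Real.cosh (p 0)) * v 0,
      v 2 * Real.sinh (p 0) - v 1 * Real.cosh (p 0)
        + (p 2 * Real.cosh (p 0) - p 1 * Real.sinh (p 0)) * v 0,
      -v 0] := by
  have h0 := aux_coord 0 p
  have h1 := aux_coord 1 p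
  have h2 := aux_coord 2 p
  have := aux_vec _ _ _ _ _ _ p v ((h2.mul h0.cosh).sub (h1.mul h0.sinh))
    ((h2.mul h0.sinh).sub (h1.mul h0.cosh)) h0.neg
  refine Eq.trans this ?_
  ext i
  fin_cases i <;> simp <;> ring

lemma aux_F (p v : Fin 3 → ℝ) : fderiv ℝ pcF p v =
    ![-v 2,
      -(v 0 * Real.sinh (p 2)) - v 1 * Real.cosh (p 2)
        - (p 0 * Real.cosh (p 2) + p 1 * Real.sinh (p 2)) * v 2,
      v 0 * Real.cosh (p 2) + v 1 * Real.sinh (p 2)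
        + (p 0 * Real.sinh (p 2) + p 1 * Real.cosh (p 2)) * v 2] := by
  have h0 := aux_coord 0 p
  have h1 := aux_coord 1 p
  have h2 := aux_coord 2 p
  have := aux_vec _ _ _ _ _ _ p v h2.neg ((h0.mul h2.sinh).neg.sub (h1.mul h2.cosh))
    ((h0.mul h2.cosh).add (h1.mul h2.sinh))
  refine Eq.trans this ?_
  ext i
  fin_cases i <;> simp <;> ring

lemma aux_eta (p v : Fin 3 → ℝ) : pcEta₀ p v = (v 2 - p 1 * v 0) / 2 := by
  have h := Real.cosh_sq (p 0)
  simp only [pcEta₀, aux_f, pcEta, pcf]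
  simp
  linear_combination (v 2 - p 1 * v 0) * h

lemma aux_deta (p u v : Fin 3 → ℝ) :
    fderiv ℝ (fun q => pcEta₀ q v) p u = -(u 1 * v 0) / 2 := by
  simp only [aux_eta]
  have h := (((aux_coord 1 p).mul_const (v 0)).const_sub (v 2)).mul_const (2⁻¹ : ℝ)
  simp only [div_eq_mul_inv]
  rw [h.fderiv]
  simp
  ring

lemma aux_fF (p w : Fin 3 → ℝ) : fderiv ℝ pcf p (fderiv ℝ pcF (pcf p) w) = w := by
  have h := Real.cosh_sq (p 0)
  rw [aux_f, aux_F]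
  ext i
  fin_cases i <;> simp [pcf]
  · linear_combination (w 0 + w 2 * (p 2 * Real.sinh (p 0) - p 1 * Real.cosh (p 0))) * h
  · linear_combination (w 1 + w 2 * (p 2 * Real.cosh (p 0) - p 1 * Real.sinh (p 0))) * h

/-- `(η₀, g₀, φ₀)` is a paracontact metric structure for the standard
paracontact form: `dη₀_p(u,v) = g₀_p(u, φ₀_p v)`, where
`dη₀_p(u,v) = ½(D_u[q ↦ η₀_q(v)](p) − D_v[q ↦ η₀_q(u)](p))` with `D` the
Fréchet derivative. Thus `g₀ = f*g` is an associated metric for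
`η₀ = ½(dz − y dx)`. -/
theorem pc_example_pullback_is_paracontact_metric (p u v : Fin 3 → ℝ) :
    (fderiv ℝ (fun q => pcEta₀ q v) p u
        - fderiv ℝ (fun q => pcEta₀ q u) p v) / 2
      = pcG₀ p u (pcPhi₀ p v) := by
  rw [aux_deta, aux_deta, pcG₀, pcPhi₀, aux_fF, aux_f, aux_f]
  have h := Real.cosh_sq (p 0)
  simp [pcG, pcPhi, pcf]
  linear_combination (u 1 * v 0 - u 0 * v 1) / 4 * h
end
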